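/- (Even–Gillis, k = 3) For all natural numbers n₁, n₂, n₃, the multiset derangement number D(n₁, n₂, n₃) equals the signed Laguerre linearization coefficient: D(n₁, n₂, n₃) = (−1)^{n₁+n₂+n₃} ∫₀^∞ L_{n₁}(x) L_{n₂}(x) L_{n₃}(x) e^{−x} dx. -/

import Mathlib

/-- The "address" map: position `j` of `Fin (n₁ + ⋯ + n_k)` is sent to the index `i`
of the consecutive block of size `n i` containing `j` (the first `n 0` positions get
address `0`, the next `n 1` positions get address `1`, etc.).  Formally, `addr n j`
is the least `i` such that `j < n 0 + ⋯ + n i`. -/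
def addr {k : ℕ} (n : Fin k → ℕ) (j : Fin (∑ i, n i)) : Fin k :=
  (Finset.univ.filter (fun i => (j : ℕ) < ∑ i' ∈ Finset.univ.filter (· ≤ i), n i')).min'
    (by
      match k with
      | 0 => exact absurd j.2 (by simp)
      | m + 1 =>
        refine ⟨Fin.last m, ?_⟩
        simp only [Finset.mem_filter, Finset.mem_univ, true_and]
        have h : Finset.univ.filter (· ≤ Fin.last m) = (Finset.univ : Finset (Fin (m + 1))) := by
          ext i; simp [Fin.le_last]
        rw [h]
        exact j.2)

/-- The multiset derangement number `D(n₁, …, n_k)`: the number of functions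
`f : Fin (n₁ + ⋯ + n_k) → Fin k` such that each fiber `f⁻¹(i)` has exactly `n i`
elements and `f j ≠ addr n j` for every position `j`. -/
def multiD (k : ℕ) (n : Fin k → ℕ) : ℕ :=
  Fintype.card {f : Fin (∑ i, n i) → Fin k //
    (∀ i, (Finset.univ.filter (fun j => f j = i)).card = n i) ∧ ∀ j, f j ≠ addr n j}


open Nat

/-- The `n`-th Laguerre polynomial, `L_n(x) = ∑_{k=0}^{n} (−1)^k (n choose k) x^k / k!`. -/
noncomputable def laguerre (n : ℕ) (x : ℝ) : ℝ :=
  ∑ k ∈ Finset.range (n + 1), (-1 : ℝ) ^ k * (n.choose k : ℝ) * x ^ k / (k ! : ℝ)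


open MvPolynomial in
lemma eg_coeff {k N : ℕ} (n : Fin k → ℕ) (b : Fin N → Fin k) :
    (Fintype.card {f : Fin N → Fin k //
      (∀ i, (Finset.univ.filter (fun j => f j = i)).card = n i) ∧ ∀ j, f j ≠ b j} : ℝ) =
    coeff (Finsupp.equivFunOnFinite.symm n)
      (∏ j, ((∑ c, X c) - X (b j) : MvPolynomial (Fin k) ℝ)) := by
  have h1 : ∀ j, ((∑ c, X c) - X (b j) : MvPolynomial (Fin k) ℝ) =
      ∑ c ∈ Finset.univ.erase (b j), X c := by
    intro j
    rw [sub_eq_iff_eq_add, Finset.sum_erase_add _ _ (Finset.mem_univ _)]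
  simp_rw [h1]
  rw [Finset.prod_univ_sum, coeff_sum]
  have h2 : ∀ f : Fin N → Fin k, (∏ j, X (f j) : MvPolynomial (Fin k) ℝ) =
      monomial (Finsupp.equivFunOnFinite.symm
        (fun i => (Finset.univ.filter (fun j => f j = i)).card)) 1 := by
    intro f
    rw [monomial_eq]
    simp only [map_one, one_mul]
    rw [Finsupp.prod_fintype _ _ (by simp)]
    rw [← Finset.prod_fiberwise (s := Finset.univ) (g := f)]
    refine Finset.prod_congr rfl fun i _ => ?_
    rw [Finset.prod_congr rfl (g := fun _ => X i)]
    · simp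
    · intro j hj
      simp at hj
      rw [hj]
  simp_rw [h2, coeff_monomial]
  rw [Finset.sum_boole, Fintype.card_subtype]
  congr 2
  ext f
  simp [funext_iff, and_comm]

open MvPolynomial in
lemma eg_pow {k : ℕ} (m s : Fin k → ℕ) (K : ℕ) (hK : K = ∑ i, m i) :
    coeff (Finsupp.equivFunOnFinite.symm (m + s))
      ((∑ c, X c) ^ K * ∏ i, (- X i) ^ (s i) : MvPolynomial (Fin k) ℝ) =
    (K ! : ℝ) * ∏ i, ((-1) ^ (s i) / ((m i)! : ℝ)) := by
  have h2 : ∀ f : Fin k → ℕ, (∏ j, X j ^ f j : MvPolynomial (Fin k) ℝ) =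
      monomial (Finsupp.equivFunOnFinite.symm f) 1 := by
    intro f
    rw [monomial_eq]
    simp only [map_one, one_mul]
    rw [Finsupp.prod_fintype _ _ (by simp)]
    simp
  have h3 : (∏ i, (- X i) ^ (s i) : MvPolynomial (Fin k) ℝ) =
      monomial (Finsupp.equivFunOnFinite.symm s) (∏ i, (-1) ^ (s i)) := by
    have : ∀ i, ((- X i) ^ (s i) : MvPolynomial (Fin k) ℝ) = C ((-1) ^ (s i)) * X i ^ s i := by
      intro i
      rw [neg_pow]; simp
    simp_rw [this, Finset.prod_mul_distrib, h2, ← map_prod, C_mul_monomial, mul_one]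
  have h4 : (Finsupp.equivFunOnFinite.symm (m + s)) =
      Finsupp.equivFunOnFinite.symm m + Finsupp.equivFunOnFinite.symm s := by
    ext; simp
  rw [h3, h4, coeff_mul_monomial, Finset.sum_pow_eq_sum_piAntidiag, coeff_sum]
  simp_rw [h2]
  have h5 : ∀ f : Fin k → ℕ, coeff (Finsupp.equivFunOnFinite.symm m)
      ((Nat.multinomial Finset.univ f : MvPolynomial (Fin k) ℝ) *
        monomial (Finsupp.equivFunOnFinite.symm f) 1) =
      if f = m then (Nat.multinomial Finset.univ m : ℝ) else 0 := by
    intro f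
    rw [← map_natCast (C : ℝ →+* MvPolynomial (Fin k) ℝ), C_mul_monomial, coeff_monomial]
    by_cases h : f = m <;> simp [h]
  simp_rw [h5]
  rw [Finset.sum_ite_eq' , if_pos (by simp [hK]), Finset.prod_div_distrib]
  have h6 := Nat.multinomial_spec Finset.univ m
  rw [← hK] at h6
  rw [← h6]
  push_cast
  have : (∏ i, ((m i)! : ℝ)) ≠ 0 := Finset.prod_ne_zero_iff.2 fun i _ => by positivity
  field_simp

open MvPolynomial in
lemma eg_sum {k : ℕ} (n : Fin k → ℕ) :
    coeff (Finsupp.equivFunOnFinite.symm n)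
      (∏ i, ((∑ c, X c) - X i : MvPolynomial (Fin k) ℝ) ^ n i) =
    ∑ m ∈ Fintype.piFinset (fun i => Finset.range (n i + 1)),
      ((∑ i, m i)! : ℝ) * ∏ i, ((-1) ^ (n i - m i) * ((n i).choose (m i) : ℝ) / ((m i)! : ℝ)) := by
  simp_rw [sub_eq_add_neg, add_pow]
  rw [Finset.prod_univ_sum, coeff_sum]
  refine Finset.sum_congr rfl fun m hm => ?_
  have hm' : ∀ i, m i ≤ n i := by
    intro i
    have := Fintype.mem_piFinset.1 hm i
    simp at this; omega
  rw [Finset.prod_mul_distrib, Finset.prod_mul_distrib, Finset.prod_pow_eq_pow_sum]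
  have e := eg_pow m (fun i => n i - m i) (∑ i, m i) rfl
  have e2 : m + (fun i => n i - m i) = n := by
    ext i; simp [hm' i]
  rw [e2] at e
  have e3 : (∏ i, ((n i).choose (m i) : MvPolynomial (Fin k) ℝ)) =
      C (∏ i, ((n i).choose (m i) : ℝ)) := by simp
  rw [e3, mul_comm, coeff_C_mul, e, mul_comm, mul_assoc, ← Finset.prod_mul_distrib]
  congr 1
  refine Finset.prod_congr rfl fun i _ => by ring

lemma eg_int (m : ℕ) : MeasureTheory.IntegrableOn (fun x : ℝ => x ^ m * Real.exp (-x)) (Set.Ioi 0) ∧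
    ∫ x in Set.Ioi (0 : ℝ), x ^ m * Real.exp (-x) = (m ! : ℝ) := by
  have h : ∀ x : ℝ, Real.exp (-x) * x ^ ((m + 1 : ℝ) - 1) = x ^ m * Real.exp (-x) := by
    intro x
    rw [add_sub_cancel_right, Real.rpow_natCast, mul_comm]
  have h1 := Real.GammaIntegral_convergent (s := m + 1) (by positivity)
  have h2 := Real.Gamma_eq_integral (s := m + 1) (by positivity)
  simp_rw [h] at h1 h2
  exact ⟨h1, by rw [← h2, Real.Gamma_nat_eq_factorial]⟩

lemma eg_integral {k : ℕ} (n : Fin k → ℕ) :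
    (-1 : ℝ) ^ (∑ i, n i) * ∫ x in Set.Ioi (0 : ℝ), (∏ i, laguerre (n i) x) * Real.exp (-x) =
    ∑ m ∈ Fintype.piFinset (fun i => Finset.range (n i + 1)),
      ((∑ i, m i)! : ℝ) * ∏ i, ((-1) ^ (n i - m i) * ((n i).choose (m i) : ℝ) / ((m i)! : ℝ)) := by
  have h : ∀ x : ℝ, (∏ i, laguerre (n i) x) * Real.exp (-x) =
      ∑ m ∈ Fintype.piFinset (fun i => Finset.range (n i + 1)),
        (∏ i, ((-1) ^ m i * ((n i).choose (m i) : ℝ) / ((m i)! : ℝ))) *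
          (x ^ (∑ i, m i) * Real.exp (-x)) := by
    intro x
    simp only [laguerre]
    rw [Finset.prod_univ_sum, Finset.sum_mul]
    refine Finset.sum_congr rfl fun m _ => ?_
    rw [← mul_assoc, ← Finset.prod_pow_eq_pow_sum, ← Finset.prod_mul_distrib]
    congr 1
    refine Finset.prod_congr rfl fun i _ => by ring
  simp_rw [h]
  rw [MeasureTheory.integral_finsetSum _ fun m _ => (eg_int _).1.const_mul _, Finset.mul_sum]
  refine Finset.sum_congr rfl fun m hm => ?_
  rw [MeasureTheory.integral_const_mul, (eg_int _).2, ← Finset.prod_pow_eq_pow_sum, ← mul_assoc,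
    ← Finset.prod_mul_distrib, mul_comm]
  congr 1
  refine Finset.prod_congr rfl fun i _ => ?_
  have := Fintype.mem_piFinset.1 hm i
  obtain ⟨d, hd⟩ := Nat.exists_eq_add_of_le (show m i ≤ n i by simp at this; omega)
  have e : (-1 : ℝ) ^ n i * (-1) ^ m i = (-1) ^ (n i - m i) := by
    rw [hd, Nat.add_sub_cancel_left, ← pow_add, show m i + d + m i = 2 * m i + d by ring,
      pow_add, pow_mul]
    simp
  rw [← e]; ring

lemma eg_addr_iff {k : ℕ} (n : Fin k → ℕ) (j : Fin (∑ i, n i)) (i : Fin k) :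
    addr n j = i ↔ (j : ℕ) < ∑ i' ∈ Finset.univ.filter (· ≤ i), n i' ∧
      ∀ l, (j : ℕ) < ∑ i' ∈ Finset.univ.filter (· ≤ l), n i' → i ≤ l := by
  unfold addr
  rw [Finset.min'_eq_iff]
  simp

lemma eg_fiber (n₁ n₂ n₃ : ℕ) (i : Fin 3) :
    (Finset.univ.filter (fun j => addr ![n₁, n₂, n₃] j = i)).card = ![n₁, n₂, n₃] i := by
  have hN : ∑ i, ![n₁, n₂, n₃] i = n₁ + n₂ + n₃ := by simp [Fin.sum_univ_three]
  have key : ∀ a b : ℕ, b - a = ![n₁, n₂, n₃] i → b ≤ n₁ + n₂ + n₃ →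
      (∀ j : Fin (∑ i, ![n₁, n₂, n₃] i), addr ![n₁, n₂, n₃] j = i ↔ a ≤ (j : ℕ) ∧ (j : ℕ) < b) →
      (Finset.univ.filter (fun j => addr ![n₁, n₂, n₃] j = i)).card = ![n₁, n₂, n₃] i := by
    intro a b h1 h2 h3
    rw [← h1, ← Nat.card_Ico, ← Finset.card_map Fin.valEmbedding]
    congr 1
    ext x
    simp only [Finset.mem_map, Finset.mem_filter, Finset.mem_univ, true_and, h3, Finset.mem_Ico,
      Fin.valEmbedding_apply]
    constructor
    · rintro ⟨j, h, rfl⟩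
      exact h
    · intro h
      exact ⟨⟨x, by omega⟩, h, rfl⟩
  have s0 : ∑ i' ∈ Finset.univ.filter (· ≤ (0 : Fin 3)), ![n₁, n₂, n₃] i' = n₁ := by
    simp [Finset.sum_filter, Fin.sum_univ_three]
  have s1 : ∑ i' ∈ Finset.univ.filter (· ≤ (1 : Fin 3)), ![n₁, n₂, n₃] i' = n₁ + n₂ := by
    simp [Finset.sum_filter, Fin.sum_univ_three]
  have s2 : ∑ i' ∈ Finset.univ.filter (· ≤ (2 : Fin 3)), ![n₁, n₂, n₃] i' = n₁ + n₂ + n₃ := by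
    have h0 : (0 : Fin 3) ≤ 2 := by decide
    have h1 : (1 : Fin 3) ≤ 2 := by decide
    simp [Finset.sum_filter, Fin.sum_univ_three, h0, h1]
  have hle : ∀ a b : Fin 3, a ≤ b ↔ (a : ℕ) ≤ b := fun _ _ => Iff.rfl
  fin_cases i
  · refine key 0 n₁ (by simp) (by omega) fun j => ?_
    rw [eg_addr_iff]
    simp only [Fin.forall_fin_succ, s0, s1, s2, Fin.zero_eta]
    simp
  · refine key n₁ (n₁ + n₂) (by simp) (by omega) fun j => ?_
    rw [eg_addr_iff]
    simp only [Fin.mk_one, s1]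
    constructor
    · rintro ⟨h1, h2⟩
      have := h2 0
      rw [s0] at this
      simp at this
      omega
    · rintro ⟨h1, h2⟩
      refine ⟨h2, fun l hl => ?_⟩
      fin_cases l
      · simp only [Fin.zero_eta, s0] at hl; omega
      · decide
      · decide
  · refine key (n₁ + n₂) (n₁ + n₂ + n₃) (by simp) (by omega) fun j => ?_
    rw [eg_addr_iff]
    simp only [Fin.reduceFinMk, s2]
    constructor
    · rintro ⟨h1, h2⟩
      have := h2 1
      rw [s1] at this
      have h3 : ¬ ((2 : Fin 3) ≤ 1) := by decide
      simp only [h3, imp_false] at this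
      omega
    · rintro ⟨h1, h2⟩
      refine ⟨h2, fun l hl => ?_⟩
      fin_cases l
      · simp only [Fin.zero_eta, s0] at hl; omega
      · simp only [Fin.mk_one, s1] at hl; omega
      · decide

/-- (Even–Gillis, `k = 3`.)  The multiset derangement number equals the signed Laguerre
linearization coefficient:
`D(n₁, n₂, n₃) = (−1)^{n₁+n₂+n₃} ∫₀^∞ L_{n₁}(x) L_{n₂}(x) L_{n₃}(x) e^{−x} dx`. -/
theorem even_gillis_three (n₁ n₂ n₃ : ℕ) :
    (multiD 3 ![n₁, n₂, n₃] : ℝ) =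
      (-1 : ℝ) ^ (n₁ + n₂ + n₃) *
        ∫ x in Set.Ioi (0 : ℝ),
          laguerre n₁ x * laguerre n₂ x * laguerre n₃ x * Real.exp (-x) := by
  have h := eg_integral ![n₁, n₂, n₃]
  rw [← eg_sum] at h
  have hN : ∑ i, ![n₁, n₂, n₃] i = n₁ + n₂ + n₃ := by simp [Fin.sum_univ_three]
  have hp : ∀ x, ∏ i, laguerre (![n₁, n₂, n₃] i) x =
      laguerre n₁ x * laguerre n₂ x * laguerre n₃ x := by
    intro x; simp [Fin.prod_univ_three]
  rw [hN] at h
  simp_rw [hp] at h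
  rw [h, multiD, eg_coeff]
  congr 1
  rw [← Finset.prod_fiberwise (s := Finset.univ) (g := addr ![n₁, n₂, n₃])]
  refine Finset.prod_congr rfl fun i _ => ?_
  rw [← eg_fiber n₁ n₂ n₃ i, ← Finset.prod_const]
  refine Finset.prod_congr rfl fun j hj => ?_
  simp only [Finset.mem_filter, Finset.mem_univ, true_and] at hj
  rw [hj]
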